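/- arXiv:2110.12688 — 10 statements merged into one kernel-verified Lean document; each statement's English description precedes it below -/
import Mathlib

section
/- Let X be a Hausdorff topological space and n ≥ 1. Then the action of the symmetric group Σ_n = Equiv.Perm (Fin n) on the ordered configuration space Conf(X,n) given by σ • f = f ∘ σ⁻¹ is free, and the quotient map Conf(X,n) → Conf(X,n)/Σ_n onto the unordered configuration space is a covering map. -/
/-- The ordered configuration space of `n` points in `X`:
the subspace `{f : Fin n → X | f injective}` of the product `X ^ (Fin n)`. -/
abbrev Conf (X : Type*) [TopologicalSpace X] (n : ℕ) : Type _ :=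
  {f : Fin n → X // Function.Injective f}

/-- The symmetric group `Σ_n = Equiv.Perm (Fin n)` acts on `Conf X n` by `σ • f = f ∘ σ⁻¹`. -/
instance confMulAction (X : Type*) [TopologicalSpace X] (n : ℕ) :
    MulAction (Equiv.Perm (Fin n)) (Conf X n) where
  smul σ f := ⟨f.1 ∘ ⇑σ⁻¹, f.2.comp (Equiv.injective _)⟩
  one_smul _ := Subtype.ext rfl
  mul_smul _ _ _ := Subtype.ext rfl

/-- The unordered configuration space `UConf X n = Conf(X,n)/Σ_n`, with the quotient topology. -/
abbrev UConf (X : Type*) [TopologicalSpace X] (n : ℕ) : Type _ :=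
  Quotient (MulAction.orbitRel (Equiv.Perm (Fin n)) (Conf X n))

theorem conf_smul_apply {X : Type*} [TopologicalSpace X] {n : ℕ} (σ : Equiv.Perm (Fin n))
    (f : Conf X n) (i : Fin n) : (σ • f).1 i = f.1 (σ⁻¹ i) := rfl

instance conf_continuousConstSMul (X : Type*) [TopologicalSpace X] (n : ℕ) :
    ContinuousConstSMul (Equiv.Perm (Fin n)) (Conf X n) where
  continuous_const_smul σ := continuous_induced_rng.mpr <|
    continuous_pi fun i => (continuous_apply (σ⁻¹ i)).comp continuous_subtype_val

theorem perm_eq_one_of_conf_apply_eq {X : Type*} [TopologicalSpace X] {n : ℕ}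
    {σ : Equiv.Perm (Fin n)} {f : Conf X n} (h : ∀ i, f.1 (σ⁻¹ i) = f.1 i) : σ = 1 :=
  inv_eq_one.mp (Equiv.ext fun i => f.2 (h i))

/-- Each configuration in a Hausdorff space has a neighborhood disjoint from its translates by
nontrivial permutations. -/
theorem conf_exists_nhds_disjoint_smul {X : Type*} [TopologicalSpace X] [T2Space X] {n : ℕ}
    (f : Conf X n) :
    ∃ U ∈ nhds f, ∀ σ : Equiv.Perm (Fin n), ((σ • ·) '' U ∩ U).Nonempty → σ = 1 := by
  obtain ⟨V, hV, hdisj⟩ := (Set.finite_range f.1).t2_separation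
  refine ⟨{g | ∀ i, g.1 i ∈ V (f.1 i)}, ?_, ?_⟩
  · refine IsOpen.mem_nhds ?_ fun i => (hV (f.1 i)).1
    rw [Set.ofPred_forall]
    exact isOpen_iInter_of_finite fun i =>
      (hV (f.1 i)).2.preimage ((continuous_apply i).comp continuous_subtype_val)
  · rintro σ ⟨_, ⟨g, hg, rfl⟩, hσg⟩
    refine perm_eq_one_of_conf_apply_eq (f := f) fun i => ?_
    exact hdisj.elim_set (Set.mem_range_self _) (Set.mem_range_self _) (g.1 (σ⁻¹ i))
      (hg (σ⁻¹ i)) (hσg i)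

theorem isQuotientCoveringMap_uconf_mk (X : Type*) [TopologicalSpace X] [T2Space X] (n : ℕ) :
    IsQuotientCoveringMap
      (Quotient.mk (MulAction.orbitRel (Equiv.Perm (Fin n)) (Conf X n)) : Conf X n → UConf X n)
      (Equiv.Perm (Fin n)) where
  __ := isQuotientMap_quotient_mk'
  __ := conf_continuousConstSMul X n
  apply_eq_iff_mem_orbit := Quotient.eq''
  disjoint := conf_exists_nhds_disjoint_smul

/-- The action of the symmetric group on the ordered configuration space of a Hausdorff
space is free, and the quotient map onto the unordered configuration space is a covering map. -/
theorem stmt0 (X : Type*) [TopologicalSpace X] [T2Space X] (n : ℕ) (hn : 1 ≤ n) :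
    (∀ (σ : Equiv.Perm (Fin n)) (f : Conf X n), σ • f = f → σ = 1) ∧
    IsCoveringMap
      (Quotient.mk (MulAction.orbitRel (Equiv.Perm (Fin n)) (Conf X n)) :
        Conf X n → UConf X n) := by
  refine ⟨fun σ f h => ?_, (isQuotientCoveringMap_uconf_mk X n).isCoveringMap⟩
  refine perm_eq_one_of_conf_apply_eq (f := f) fun i => ?_
  rw [← conf_smul_apply, h]
end

section
/- For every n ≥ 1, the map (σ, g) ↦ g ∘ σ is a homeomorphism from Equiv.Perm (Fin n) × {g : Fin n → ℝ | g is strictly monotone increasing} onto the ordered configuration space Conf(ℝ,n), where Equiv.Perm (Fin n) carries the discrete topology and {g strictly monotone} carries the subspace topology from the product ℝ^{Fin n}. -/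
instance (n : ℕ) : TopologicalSpace (Equiv.Perm (Fin n)) := ⊥
instance (n : ℕ) : DiscreteTopology (Equiv.Perm (Fin n)) := ⟨rfl⟩

/-- Sorting an injective tuple gives a strictly increasing one. -/
theorem strictMono_comp_sort {n : ℕ} (f : Conf ℝ n) : StrictMono (f.1 ∘ Tuple.sort f.1) :=
  (Tuple.monotone_sort f.1).strictMono_of_injective (f.2.comp (Tuple.sort f.1).injective)

/-- The sorting permutation of an injective tuple is the only one which makes it
strictly increasing. -/
theorem sort_eq_of_strictMono {n : ℕ} (f : Conf ℝ n) {σ : Equiv.Perm (Fin n)}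
    (h : StrictMono (f.1 ∘ σ)) : Tuple.sort f.1 = σ := by
  ext1 i
  exact f.2 (congrFun (Tuple.unique_monotone (Tuple.monotone_sort f.1) h.monotone) i)

theorem isOpen_setOf_strictMono_comp {n : ℕ} (σ : Equiv.Perm (Fin n)) :
    IsOpen {f : Conf ℝ n | StrictMono (f.1 ∘ σ)} := by
  simp only [StrictMono, Set.ofPred_forall]
  refine isOpen_iInter_of_finite fun i => isOpen_iInter_of_finite fun j =>
    isOpen_iInter_of_finite fun _ => isOpen_lt ?_ ?_
  · exact (continuous_apply (σ i)).comp continuous_subtype_val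
  · exact (continuous_apply (σ j)).comp continuous_subtype_val

theorem isLocallyConstant_sort (n : ℕ) :
    IsLocallyConstant fun f : Conf ℝ n => Tuple.sort f.1 := by
  refine (IsLocallyConstant.iff_exists_open _).2 fun f =>
    ⟨_, isOpen_setOf_strictMono_comp (Tuple.sort f.1), strictMono_comp_sort f, ?_⟩
  exact fun g hg => sort_eq_of_strictMono g hg

/-- The map sending a pair of a permutation and a strictly increasing tuple to their
composite is a homeomorphism onto the ordered configuration space of the real line. -/
theorem stmt1 (n : ℕ) (hn : 1 ≤ n) :
    ∃ h : (Equiv.Perm (Fin n) × {g : Fin n → ℝ // StrictMono g}) ≃ₜ Conf ℝ n,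
      ∀ (σ : Equiv.Perm (Fin n)) (g : {g : Fin n → ℝ // StrictMono g}),
        (h (σ, g)).1 = g.1 ∘ ⇑σ := by
  have sort_comp (σ : Equiv.Perm (Fin n)) (g : {g : Fin n → ℝ // StrictMono g}) :
      Tuple.sort (g.1 ∘ σ) = σ⁻¹ :=
    sort_eq_of_strictMono ⟨g.1 ∘ σ, g.2.injective.comp σ.injective⟩ <| by
      simpa [Function.comp_assoc] using g.2
  refine ⟨{
    toFun := fun p => ⟨p.2.1 ∘ p.1, p.2.2.injective.comp p.1.injective⟩
    invFun := fun f => ((Tuple.sort f.1)⁻¹, ⟨f.1 ∘ Tuple.sort f.1, strictMono_comp_sort f⟩)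
    left_inv := ?_
    right_inv := ?_
    continuous_toFun := ?_
    continuous_invFun := ?_ }, fun _ _ => rfl⟩
  · rintro ⟨σ, g⟩
    refine Prod.ext ?_ (Subtype.ext ?_)
    · simp [sort_comp]
    · simp [sort_comp, Function.comp_assoc]
  · intro f
    exact Subtype.ext (by simp [Function.comp_assoc])
  · refine continuous_prod_of_discrete_left.2 fun σ => Continuous.subtype_mk ?_ _
    exact continuous_pi fun i => (continuous_apply (σ i)).comp continuous_subtype_val
  · refine Continuous.prodMk ((isLocallyConstant_sort n).comp _).continuous
      (Continuous.subtype_mk (continuous_iff_continuousAt.2 fun f => ?_) _)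
    have hc : Continuous fun g : Conf ℝ n => g.1 ∘ Tuple.sort f.1 :=
      continuous_pi fun i => (continuous_apply (Tuple.sort f.1 i)).comp continuous_subtype_val
    refine hc.continuousAt.congr ?_
    filter_upwards [(isLocallyConstant_sort n).eventually_eq f] with g hg
    rw [hg]
end

section
/- Let X and Y be topological spaces and n a natural number. Then the ordered configuration space Conf(X ⊕ Y, n) of the disjoint union (sum) X ⊕ Y is homeomorphic to the disjoint union, over all subsets S of Fin n, of the products {u : ↥S → X | u injective} × {v : ↥(Sᶜ) → Y | v injective}, i.e. to the sigma type Σ (S : Finset (Fin n)), ({u : {i // i ∈ S} → X // Injective u} × {v : {i // i ∉ S} → Y // Injective v}), where the homeomorphism sends an injective f : Fin n → X ⊕ Y to the set S of indices mapped into X together with the corresponding restrictions. -/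
open Function

theorem continuous_sum_isLeft {X Y : Type*} [TopologicalSpace X] [TopologicalSpace Y] :
    Continuous (Sum.isLeft : X ⊕ Y → Bool) :=
  continuous_sum_dom.2 ⟨continuous_const, continuous_const⟩

namespace Conf

variable {X Y : Type*} [TopologicalSpace X] [TopologicalSpace Y] {n : ℕ}

/-- The indices of the points of a configuration in `X ⊕ Y` that lie in `X`. -/
def leftIndices (f : Conf (X ⊕ Y) n) : Finset (Fin n) :=
  Finset.univ.filter (fun i => (f.1 i).isLeft = true)

theorem mem_leftIndices {f : Conf (X ⊕ Y) n} {i : Fin n} :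
    i ∈ f.leftIndices ↔ (f.1 i).isLeft = true := by
  simp [leftIndices]

theorem isOpen_leftIndices_eq (S : Finset (Fin n)) :
    IsOpen {f : Conf (X ⊕ Y) n | f.leftIndices = S} := by
  have h : Continuous fun (f : Conf (X ⊕ Y) n) i => (f.1 i).isLeft :=
    continuous_pi fun i =>
      continuous_sum_isLeft.comp ((continuous_apply i).comp continuous_subtype_val)
  exact (isOpen_discrete {b : Fin n → Bool |
    Finset.univ.filter (fun i => b i = true) = S}).preimage h

/-- The points of a configuration in `X ⊕ Y`, split into those in `X` and those in `Y`. -/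
def split (S : Finset (Fin n)) (f : {f : Conf (X ⊕ Y) n // f.leftIndices = S}) :
    {u : {i : Fin n // i ∈ S} → X // Injective u} ×
      {v : {i : Fin n // i ∉ S} → Y // Injective v} :=
  have hl (i : {i : Fin n // i ∈ S}) : (f.1.1 i.1).isLeft = true :=
    mem_leftIndices.1 (f.2.symm ▸ i.2)
  have hr (i : {i : Fin n // i ∉ S}) : (f.1.1 i.1).isRight = true := by
    rw [← Sum.not_isLeft, ← mem_leftIndices, f.2]
    exact i.2
  (⟨fun i => (f.1.1 i.1).getLeft (hl i), fun i j hij => Subtype.ext <| f.1.2 <| by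
      rw [← Sum.inl_getLeft _ (hl i), ← Sum.inl_getLeft _ (hl j)]
      exact congrArg Sum.inl hij⟩,
    ⟨fun i => (f.1.1 i.1).getRight (hr i), fun i j hij => Subtype.ext <| f.1.2 <| by
      rw [← Sum.inr_getRight _ (hr i), ← Sum.inr_getRight _ (hr j)]
      exact congrArg Sum.inr hij⟩)

theorem inl_split (S : Finset (Fin n)) (f : {f : Conf (X ⊕ Y) n // f.leftIndices = S})
    (i : {i : Fin n // i ∈ S}) : Sum.inl ((split S f).1.1 i) = f.1.1 i.1 :=
  Sum.inl_getLeft _ _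

theorem inr_split (S : Finset (Fin n)) (f : {f : Conf (X ⊕ Y) n // f.leftIndices = S})
    (i : {i : Fin n // i ∉ S}) : Sum.inr ((split S f).2.1 i) = f.1.1 i.1 :=
  Sum.inr_getRight _ _

theorem continuous_split (S : Finset (Fin n)) :
    Continuous (split S : {f : Conf (X ⊕ Y) n // f.leftIndices = S} → _) := by
  have h (i : Fin n) :
      Continuous fun f : {f : Conf (X ⊕ Y) n // f.leftIndices = S} => f.1.1 i :=
    (continuous_apply i).comp (continuous_subtype_val.comp continuous_subtype_val)
  refine Continuous.prodMk (Continuous.subtype_mk (continuous_pi fun i => ?_) _)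
    (Continuous.subtype_mk (continuous_pi fun i => ?_) _)
  · refine Topology.IsEmbedding.inl.continuous_iff.2 ((h i.1).congr fun f => ?_)
    exact (inl_split S f i).symm
  · refine Topology.IsEmbedding.inr.continuous_iff.2 ((h i.1).congr fun f => ?_)
    exact (inr_split S f i).symm

/-- The configuration in `X ⊕ Y` with prescribed points in `X` and in `Y`. -/
def glue (S : Finset (Fin n)) (p : {u : {i : Fin n // i ∈ S} → X // Injective u} ×
    {v : {i : Fin n // i ∉ S} → Y // Injective v}) : Conf (X ⊕ Y) n :=
  ⟨fun i => if h : i ∈ S then Sum.inl (p.1.1 ⟨i, h⟩) else Sum.inr (p.2.1 ⟨i, h⟩), by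
    intro i j hij
    by_cases hi : i ∈ S <;> by_cases hj : j ∈ S <;> simp only [hi, hj, dite_true, dite_false,
      Sum.inl.injEq, Sum.inr.injEq, reduceCtorEq] at hij
    · exact congrArg Subtype.val (p.1.2 hij)
    · exact congrArg Subtype.val (p.2.2 hij)⟩

theorem continuous_glue (S : Finset (Fin n)) :
    Continuous (glue S : _ → Conf (X ⊕ Y) n) := by
  refine Continuous.subtype_mk (continuous_pi fun i => ?_) _
  by_cases h : i ∈ S
  · simp only [h, dite_true]
    exact continuous_inl.comp
      ((continuous_apply _).comp (continuous_subtype_val.comp continuous_fst))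
  · simp only [h, dite_false]
    exact continuous_inr.comp
      ((continuous_apply _).comp (continuous_subtype_val.comp continuous_snd))

theorem leftIndices_glue (S : Finset (Fin n))
    (p : {u : {i : Fin n // i ∈ S} → X // Injective u} ×
      {v : {i : Fin n // i ∉ S} → Y // Injective v}) : (glue S p).leftIndices = S := by
  ext i
  by_cases h : i ∈ S <;> simp [mem_leftIndices, glue, h]

theorem split_glue (S : Finset (Fin n))
    (p : {u : {i : Fin n // i ∈ S} → X // Injective u} ×
      {v : {i : Fin n // i ∉ S} → Y // Injective v}) :
    split S ⟨glue S p, leftIndices_glue S p⟩ = p := by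
  refine Prod.ext (Subtype.ext (funext fun i => ?_)) (Subtype.ext (funext fun i => ?_))
  · exact Sum.inl_injective ((inl_split S _ i).trans (by simp [glue]))
  · exact Sum.inr_injective ((inr_split S _ i).trans (by simp [glue, i.2]))

theorem glue_split (S : Finset (Fin n)) (f : {f : Conf (X ⊕ Y) n // f.leftIndices = S}) :
    glue S (split S f) = f.1 := by
  refine Subtype.ext (funext fun i => ?_)
  by_cases h : i ∈ S
  · simpa [glue, h] using inl_split S f ⟨i, h⟩
  · simpa [glue, h] using inr_split S f ⟨i, h⟩

theorem mk_split_eq {S : Finset (Fin n)} (f : {f : Conf (X ⊕ Y) n // f.leftIndices = S}) :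
    (⟨f.1.leftIndices, split _ ⟨f.1, rfl⟩⟩ : Σ S : Finset (Fin n),
      ({u : {i : Fin n // i ∈ S} → X // Injective u} ×
       {v : {i : Fin n // i ∉ S} → Y // Injective v})) = ⟨S, split S f⟩ := by
  obtain ⟨f, rfl⟩ := f
  rfl

/-- A configuration in `X ⊕ Y` is a set of indices together with a configuration in `X` indexed
by that set and a configuration in `Y` indexed by its complement. -/
def sumHomeomorph : Conf (X ⊕ Y) n ≃ₜ
    (Σ S : Finset (Fin n),
      ({u : {i : Fin n // i ∈ S} → X // Injective u} ×
       {v : {i : Fin n // i ∉ S} → Y // Injective v})) where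
  toFun f := ⟨f.leftIndices, split _ ⟨f, rfl⟩⟩
  invFun p := glue p.1 p.2
  left_inv f := glue_split _ ⟨f, rfl⟩
  right_inv p := (mk_split_eq ⟨glue p.1 p.2, leftIndices_glue p.1 p.2⟩).trans
    (congrArg (Sigma.mk p.1) (split_glue p.1 p.2))
  continuous_toFun := by
    refine continuous_iff_continuousAt.2 fun f => ContinuousOn.continuousAt
      (s := {g | g.leftIndices = f.leftIndices}) ?_
      ((isOpen_leftIndices_eq _).mem_nhds rfl)
    exact continuousOn_iff_continuous_domRestrict.2
      ((continuous_sigmaMk.comp (continuous_split f.leftIndices)).congr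
        fun g => (mk_split_eq g).symm)
  continuous_invFun := continuous_sigma continuous_glue

end Conf

/-- The ordered configuration space of a disjoint union is homeomorphic to the disjoint
union, over subsets of indices, of products of spaces of injections, via restriction
of configurations. -/
theorem stmt3 (X Y : Type*) [TopologicalSpace X] [TopologicalSpace Y] (n : ℕ) :
    ∃ h : Conf (X ⊕ Y) n ≃ₜ
        (Σ S : Finset (Fin n),
          ({u : {i : Fin n // i ∈ S} → X // Function.Injective u} ×
           {v : {i : Fin n // i ∉ S} → Y // Function.Injective v})),
      ∀ f : Conf (X ⊕ Y) n,
        (h f).1 = Finset.univ.filter (fun i => (f.1 i).isLeft = true) ∧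
        (∀ i : {i : Fin n // i ∈ (h f).1}, f.1 i.1 = Sum.inl ((h f).2.1.1 i)) ∧
        (∀ i : {i : Fin n // i ∉ (h f).1}, f.1 i.1 = Sum.inr ((h f).2.2.1 i)) := by
  exact ⟨Conf.sumHomeomorph, fun f => ⟨rfl, fun i => (Conf.inl_split _ ⟨f, rfl⟩ i).symm,
    fun i => (Conf.inr_split _ ⟨f, rfl⟩ i).symm⟩⟩
end

section
/- For every n ≥ 1, the unordered configuration space UConf(S¹,n) = Conf(S¹,n)/Σ_n is homotopy equivalent to the circle S¹. -/
open Complex in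
/-- The average over `j` of the angle from the antipode of `x i` to `x j`. -/
noncomputable def angleMean {n : ℕ} (x : Fin n → Circle) (i : Fin n) : ℝ :=
  (∑ j, arg ((-(x j / x i) : Circle) : ℂ)) / n

/-- Move each point `x i` along the circle, at constant speed in `t`, towards its position
in a regular polygon, up to a common rotation by the angle `c`. -/
noncomputable def spread {n : ℕ} (c t : ℝ) (x : Fin n → Circle) (i : Fin n) : Circle :=
  x i * Circle.exp (t * (c + angleMean x i))

lemma angleMean_comp {n : ℕ} (x : Fin n → Circle) (σ : Equiv.Perm (Fin n)) (i : Fin n) :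
    angleMean (x ∘ σ) i = angleMean x (σ i) := by
  simp only [angleMean, Function.comp_apply]
  rw [Equiv.sum_comp σ fun j => Complex.arg ((-(x j / x (σ i)) : Circle) : ℂ)]

lemma spread_comp {n : ℕ} (c t : ℝ) (x : Fin n → Circle) (σ : Equiv.Perm (Fin n)) :
    spread c t (x ∘ σ) = spread c t x ∘ σ := by
  funext i
  simp [spread, angleMean_comp]

lemma spread_zero {n : ℕ} (c : ℝ) (x : Fin n → Circle) : spread c 0 x = x := by
  funext i
  simp [spread]

lemma Circle.neg_eq_exp_pi_mul (z : Circle) : -z = Circle.exp Real.pi * z := by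
  ext
  simp [Circle.coe_exp]

lemma Circle.exp_sum {ι : Type*} (s : Finset ι) (f : ι → ℝ) :
    Circle.exp (∑ i ∈ s, f i) = ∏ i ∈ s, Circle.exp (f i) := by
  classical
  induction s using Finset.induction_on with
  | empty => simp
  | insert a s ha ih => rw [Finset.sum_insert ha, Finset.prod_insert ha, Circle.exp_add, ih]

lemma spread_one_pow {n : ℕ} (hn : 1 ≤ n) (c : ℝ) (x : Fin n → Circle) (i : Fin n) :
    spread c 1 x i ^ n = Circle.exp (n * (c + Real.pi)) * ∏ j, x j := by
  have hn' : (n : ℝ) ≠ 0 := by positivity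
  have h : (n : ℝ) * (1 * (c + angleMean x i)) =
      n * c + ∑ j, Complex.arg ((-(x j / x i) : Circle) : ℂ) := by
    rw [angleMean]
    field_simp
  rw [spread, mul_pow, ← Circle.exp_natCast_mul, h, Circle.exp_add, Circle.exp_sum]
  simp_rw [Circle.exp_arg, Circle.neg_eq_exp_pi_mul]
  rw [Finset.prod_mul_distrib, Finset.prod_div_distrib, mul_add, Circle.exp_add,
    Circle.exp_natCast_mul Real.pi]
  simp only [Finset.prod_const, Finset.card_univ, Fintype.card_fin]
  rw [mul_comm (x i ^ n), mul_assoc, mul_assoc, div_mul_cancel, mul_assoc]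

open Complex in
/-- The gap from `x i` to `x k` stays in `(0, 2π)` while the points spread out. -/
lemma angleMean_gap_mem {n : ℕ} {x : Fin n → Circle} (hx : Function.Injective x) {i k : Fin n}
    (hik : i ≠ k) :
    arg ((-(x k / x i) : Circle) : ℂ) + Real.pi + (angleMean x k - angleMean x i) ∈
      Set.Ioo 0 (2 * Real.pi) := by
  have hn : 0 < (n : ℝ) := by exact_mod_cast i.pos
  set α := arg ((-(x k / x i) : Circle) : ℂ) + Real.pi with hα
  have hα0 : 0 < α := by linarith [neg_pi_lt_arg ((-(x k / x i) : Circle) : ℂ)]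
  have hα1 : α ≤ 2 * Real.pi := by linarith [arg_le_pi ((-(x k / x i) : Circle) : ℂ)]
  have hself (l : Fin n) : arg ((-(x l / x l) : Circle) : ℂ) = Real.pi := by simp
  let A (j : Fin n) : ℝ :=
    arg ((-(x j / x k) : Circle) : ℂ) - arg ((-(x j / x i) : Circle) : ℂ) + α
  have hA (j : Fin n) : ∃ m : ℤ, A j = m * (2 * Real.pi) := by
    rw [← Circle.exp_eq_one]
    simp only [A, hα, Circle.exp_add, Circle.exp_sub, Circle.exp_arg, Circle.neg_eq_exp_pi_mul]
    have h2 : Circle.exp Real.pi * Circle.exp Real.pi = 1 := by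
      rw [← Circle.exp_add, ← two_mul, Circle.exp_two_pi]
    rw [mul_div_mul_left_eq_div, div_div_div_cancel_left, mul_right_comm, h2, one_mul,
      div_mul_div_cancel, div_self']
  have hpi := Real.pi_pos
  have hA0 (j : Fin n) : 0 ≤ A j := by
    obtain ⟨m, hm⟩ := hA j
    have h1 : -(2 * Real.pi) < A j := by
      simp only [A]
      linarith [neg_pi_lt_arg ((-(x j / x k) : Circle) : ℂ),
        arg_le_pi ((-(x j / x i) : Circle) : ℂ)]
    have h2 : (-1 : ℝ) < m := by nlinarith
    have h3 : (0 : ℝ) ≤ m := by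
      have : -1 < m := by exact_mod_cast h2
      exact_mod_cast (by omega : 0 ≤ m)
    rw [hm]
    positivity
  have hA1 (j : Fin n) : A j ≤ 2 * Real.pi := by
    obtain ⟨m, hm⟩ := hA j
    have h1 : A j < 2 * (2 * Real.pi) := by
      simp only [A]
      linarith [neg_pi_lt_arg ((-(x j / x i) : Circle) : ℂ),
        arg_le_pi ((-(x j / x k) : Circle) : ℂ)]
    have h2 : (m : ℝ) < 2 := by nlinarith
    have h3 : (m : ℝ) ≤ 1 := by
      have : m < 2 := by exact_mod_cast h2
      exact_mod_cast (by omega : m ≤ 1)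
    rw [hm]
    nlinarith
  have hAk : 0 < A k := by
    simp only [A, hself, hα]
    linarith
  have hAi : A i < 2 * Real.pi := by
    have h1 : arg ((-(x i / x k) : Circle) : ℂ) ≠ Real.pi := by
      rw [← hself i, Ne, Circle.arg_eq_arg, neg_inj, div_self', div_eq_one]
      exact fun h => hik (hx h)
    have h2 := lt_of_le_of_ne (arg_le_pi _) h1
    simp only [A, hself]
    linarith
  have hsum : (∑ j, A j) / n = α + (angleMean x k - angleMean x i) := by
    simp only [A, angleMean, Finset.sum_add_distrib, Finset.sum_sub_distrib, Finset.sum_const,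
      Finset.card_univ, Fintype.card_fin, nsmul_eq_mul]
    field_simp
    ring
  rw [← hsum]
  constructor
  · exact div_pos (Finset.sum_pos' (fun j _ => hA0 j) ⟨k, Finset.mem_univ _, hAk⟩) hn
  · rw [div_lt_iff₀ hn]
    calc ∑ j, A j < ∑ _j : Fin n, 2 * Real.pi :=
          Finset.sum_lt_sum (fun j _ => hA1 j) ⟨i, Finset.mem_univ _, hAi⟩
      _ = 2 * Real.pi * n := by simp [mul_comm]

open Complex in
lemma spread_injective {n : ℕ} {x : Fin n → Circle} (hx : Function.Injective x) (c : ℝ) {t : ℝ}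
    (ht : t ∈ Set.Icc (0 : ℝ) 1) : Function.Injective (spread c t x) := by
  intro i k h
  by_contra hik
  have hgap := angleMean_gap_mem hx hik
  set α := arg ((-(x k / x i) : Circle) : ℂ) + Real.pi with hα
  have hα_exp : Circle.exp α = x k / x i := by
    rw [hα, Circle.exp_add, Circle.exp_arg, mul_comm, ← Circle.neg_eq_exp_pi_mul, neg_neg]
  have hα_mem : α ∈ Set.Ioo 0 (2 * Real.pi) := by
    refine ⟨by linarith [neg_pi_lt_arg ((-(x k / x i) : Circle) : ℂ)], ?_⟩
    refine lt_of_le_of_ne (by linarith [arg_le_pi ((-(x k / x i) : Circle) : ℂ)]) fun h' => ?_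
    rw [h', Circle.exp_two_pi, eq_comm, div_eq_one] at hα_exp
    exact hik (hx hα_exp).symm
  have hmem : (1 - t) * α + t * (α + (angleMean x k - angleMean x i)) ∈
      Set.Ioo 0 (2 * Real.pi) :=
    convex_Ioo 0 (2 * Real.pi) hα_mem hgap (by linarith [ht.2]) ht.1 (by ring)
  have hone : Circle.exp ((1 - t) * α + t * (α + (angleMean x k - angleMean x i))) = 1 := by
    have : (1 - t) * α + t * (α + (angleMean x k - angleMean x i)) =
        α + (t * (c + angleMean x k) - t * (c + angleMean x i)) := by ring
    rw [this, Circle.exp_add, Circle.exp_sub, hα_exp, div_mul_div_comm, div_eq_one]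
    exact h.symm
  obtain ⟨m, hm⟩ := Circle.exp_eq_one.1 hone
  rw [hm] at hmem
  have hpi := Real.pi_pos
  have h0 : (0 : ℝ) < m := by nlinarith [hmem.1]
  have h1 : (m : ℝ) < 1 := by nlinarith [hmem.2]
  have h0' : 0 < m := by exact_mod_cast h0
  have h1' : m < 1 := by exact_mod_cast h1
  omega

lemma Conf.continuous_eval {X : Type*} [TopologicalSpace X] {n : ℕ} (i : Fin n) :
    Continuous fun x : Conf X n => x.1 i :=
  (continuous_apply i).comp continuous_subtype_val

lemma continuous_angleMean {n : ℕ} (i : Fin n) :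
    Continuous fun x : Conf Circle n => angleMean x.1 i := by
  refine Continuous.div_const (continuous_finsetSum _ fun j _ => ?_) _
  rcases eq_or_ne j i with rfl | hji
  · simpa using continuous_const
  · refine continuous_iff_continuousAt.2 fun x => ?_
    have harg : ((-(x.1 j / x.1 i) : Circle) : ℂ) ∈ Complex.slitPlane := by
      rw [Complex.mem_slitPlane_iff_arg]
      refine ⟨fun h => hji (x.2 ?_), Circle.coe_ne_zero _⟩
      have : -(x.1 j / x.1 i) = -1 := by
        rw [← Circle.arg_eq_arg, h]
        simp
      rwa [neg_inj, div_eq_one] at this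
    have hdiv : Continuous fun x : Conf Circle n => x.1 j / x.1 i :=
      (Conf.continuous_eval j).div' (Conf.continuous_eval i)
    refine (Complex.continuousAt_arg harg).comp (f := fun x : Conf Circle n =>
      ((-(x.1 j / x.1 i) : Circle) : ℂ)) (Continuous.continuousAt ?_)
    simp only [Circle.coe_neg]
    exact (continuous_subtype_val.comp hdiv).neg

/-- The deformation of ordered configurations given by `spread`. -/
noncomputable def confSpread (n : ℕ) (c : ℝ) : C(unitInterval × Conf Circle n, Conf Circle n) where
  toFun p := ⟨spread c p.1 p.2.1, spread_injective p.2.2 c p.1.2⟩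
  continuous_toFun := by
    refine Continuous.subtype_mk (continuous_pi fun i => ?_) _
    have h : Continuous fun p : unitInterval × Conf Circle n => angleMean p.2.1 i :=
      (continuous_angleMean i).comp continuous_snd
    have h' : Continuous fun p : unitInterval × Conf Circle n =>
        (p.1 : ℝ) * (c + angleMean p.2.1 i) := by fun_prop
    exact ((Conf.continuous_eval i).comp continuous_snd).mul (Circle.exp.continuous.comp h')

instance (X : Type*) [TopologicalSpace X] (n : ℕ) :
    ContinuousConstSMul (Equiv.Perm (Fin n)) (Conf X n) where
  continuous_const_smul σ := by
    refine Continuous.subtype_mk (f := fun x : Conf X n => x.1 ∘ ⇑σ⁻¹) ?_ _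
    exact continuous_pi fun i => Conf.continuous_eval (σ⁻¹ i)

lemma Conf.mk_eq_mk_of_range_eq {X : Type*} [TopologicalSpace X] {n : ℕ} {x y : Conf X n}
    (h : Set.range x.1 = Set.range y.1) : (⟦x⟧ : UConf X n) = ⟦y⟧ := by
  let σ : Equiv.Perm (Fin n) := (Equiv.ofInjective x.1 x.2).trans
    ((Equiv.setCongr h).trans (Equiv.ofInjective y.1 y.2).symm)
  refine Quotient.sound ⟨σ⁻¹, Subtype.ext (funext fun i => ?_)⟩
  change y.1 (σ⁻¹⁻¹ i) = x.1 i
  rw [inv_inv]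
  exact Equiv.apply_ofInjective_symm y.2 _

/-- Two configurations of `n` points consisting of `n`-th roots of the same element agree. -/
lemma Conf.mk_eq_mk_of_pow_eq {n : ℕ} (hn : 1 ≤ n) {x y : Conf Circle n} {z : Circle}
    (hx : ∀ i, x.1 i ^ n = z) (hy : ∀ i, y.1 i ^ n = z) : (⟦x⟧ : UConf Circle n) = ⟦y⟧ := by
  classical
  have key (w : Conf Circle n) (hw : ∀ i, w.1 i ^ n = z) :
      Finset.univ.image (fun i => (w.1 i : ℂ)) = Polynomial.nthRootsFinset n (z : ℂ) := by
    refine Finset.eq_of_subset_of_card_le (fun u hu => ?_) ?_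
    · obtain ⟨i, -, rfl⟩ := Finset.mem_image.1 hu
      rw [Polynomial.mem_nthRootsFinset hn, ← hw i, Circle.coe_pow]
    · rw [Finset.card_image_of_injective _ fun _ _ h => w.2 (Circle.coe_injective h),
        Finset.card_univ, Fintype.card_fin, Polynomial.nthRootsFinset_def]
      exact (Multiset.toFinset_card_le _).trans (Polynomial.card_nthRoots n _)
  have h : (Set.range fun i => (x.1 i : ℂ)) = Set.range fun i => (y.1 i : ℂ) := by
    simpa using congrArg (fun s : Finset ℂ => (s : Set ℂ)) ((key x hx).trans (key y hy).symm)
  refine Conf.mk_eq_mk_of_range_eq (Set.Subset.antisymm ?_ ?_)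
  · rintro _ ⟨i, rfl⟩
    obtain ⟨j, hj⟩ := h.subset ⟨i, rfl⟩
    exact ⟨j, Circle.coe_injective hj⟩
  · rintro _ ⟨i, rfl⟩
    obtain ⟨j, hj⟩ := h.superset ⟨i, rfl⟩
    exact ⟨j, Circle.coe_injective hj⟩

lemma Circle.exists_isPrimitiveRoot {n : ℕ} (hn : 1 ≤ n) : ∃ ζ : Circle, IsPrimitiveRoot ζ n := by
  refine ⟨Circle.exp (2 * Real.pi / n), .of_map_of_injective (f := Circle.coeHom) ?_
    Circle.coe_injective⟩
  convert Complex.isPrimitiveRoot_exp n (by omega) using 1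
  change Complex.exp ((2 * Real.pi / n : ℝ) * Complex.I) = _
  push_cast
  ring_nf

/-- The vertices of a regular polygon with vertex `w`. -/
noncomputable def regularPolygon {n : ℕ} {ζ : Circle} (hζ : IsPrimitiveRoot ζ n) :
    C(Circle, Conf Circle n) where
  toFun w := ⟨fun i => ζ ^ (i : ℕ) * w, fun _ _ h =>
    Fin.ext (hζ.pow_inj (Fin.is_lt _) (Fin.is_lt _) (mul_right_cancel h))⟩
  continuous_toFun := by
    refine Continuous.subtype_mk (continuous_pi fun i => ?_) _
    fun_prop

lemma regularPolygon_pow {n : ℕ} {ζ : Circle} (hζ : IsPrimitiveRoot ζ n) (w : Circle) (i : Fin n) :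
    (regularPolygon hζ w).1 i ^ n = w ^ n := by
  change (ζ ^ (i : ℕ) * w) ^ n = w ^ n
  rw [mul_pow, pow_right_comm, hζ.pow_eq_one, one_pow, one_mul]

/-- The unordered configuration space of the circle is homotopy equivalent to the circle. -/
theorem stmt4 (n : ℕ) (hn : 1 ≤ n) :
    Nonempty (ContinuousMap.HomotopyEquiv (UConf Circle n) Circle) := by
  have : NeZero n := ⟨by omega⟩
  obtain ⟨ζ, hζ⟩ := Circle.exists_isPrimitiveRoot hn
  have hpow : Topology.IsQuotientMap (⟨(· ^ n), by fun_prop⟩ : C(Circle, Circle)) :=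
    (Circle.isQuotientCoveringMap_npow n).toIsQuotientMap
  have hmk : IsOpenQuotientMap (Quotient.mk _ : Conf Circle n → UConf Circle n) :=
    MulAction.isOpenQuotientMap_quotientMk
  let ε : Circle := ∏ i : Fin n, ζ ^ (i : ℕ)
  obtain ⟨b, hb⟩ := Circle.exp_surjective ε⁻¹
  let c : ℝ := b / n - Real.pi
  have hc : Circle.exp (n * (c + Real.pi)) = ε⁻¹ := by
    rw [← hb]
    congr 1
    simp only [c]
    field_simp
    ring
  let f : C(UConf Circle n, Circle) :=
    { toFun := Quotient.lift (fun x : Conf Circle n => ε⁻¹ * ∏ i, x.1 i) (by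
        rintro _ y ⟨σ, rfl⟩
        exact congrArg (ε⁻¹ * ·) (Equiv.prod_comp σ⁻¹ y.1))
      continuous_toFun := Continuous.quotient_lift (by fun_prop) _ }
  let poly : C(Circle, UConf Circle n) :=
    (⟨Quotient.mk _, hmk.continuous⟩ : C(Conf Circle n, UConf Circle n)).comp (regularPolygon hζ)
  have hpoly : Function.FactorsThrough poly (⟨(· ^ n), by fun_prop⟩ : C(Circle, Circle)) :=
    fun w w' h => Conf.mk_eq_mk_of_pow_eq hn (regularPolygon_pow hζ w)
      fun i => (regularPolygon_pow hζ w' i).trans h.symm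
  let g : C(Circle, UConf Circle n) := hpow.lift poly hpoly
  have hg (w : Circle) : g (w ^ n) = ⟦regularPolygon hζ w⟧ :=
    DFunLike.congr_fun (hpow.lift_comp poly hpoly) w
  have hfg : f.comp g = ContinuousMap.id Circle := by
    ext1 z
    obtain ⟨w, rfl⟩ := hpow.surjective z
    change f (g (w ^ n)) = w ^ n
    rw [hg]
    change ε⁻¹ * ∏ i : Fin n, (ζ ^ (i : ℕ) * w) = w ^ n
    rw [Finset.prod_mul_distrib]
    simp [ε]
  let K : unitInterval × UConf Circle n → UConf Circle n := fun p =>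
    Quotient.map (fun x => confSpread n c (p.1, x)) (by
      rintro _ y ⟨σ, rfl⟩
      exact ⟨σ, Subtype.ext (spread_comp c p.1 y.1 σ⁻¹).symm⟩) p.2
  have hK : Continuous K := by
    rw [← (IsOpenQuotientMap.id.prodMap hmk).continuous_comp_iff]
    exact hmk.continuous.comp (confSpread n c).continuous
  let H : ContinuousMap.Homotopy (ContinuousMap.id (UConf Circle n)) (g.comp f) :=
    { toFun := K
      continuous_toFun := hK
      map_zero_left := by
        rintro ⟨x⟩
        exact congrArg (Quotient.mk _) (Subtype.ext (spread_zero c x.1))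
      map_one_left := by
        rintro ⟨x⟩
        obtain ⟨w, hw⟩ := hpow.surjective (ε⁻¹ * ∏ i, x.1 i)
        change w ^ n = _ at hw
        change (⟦confSpread n c (1, x)⟧ : UConf Circle n) = g (ε⁻¹ * ∏ i, x.1 i)
        rw [← hw, hg]
        refine Conf.mk_eq_mk_of_pow_eq hn (fun i => ?_) (regularPolygon_pow hζ w)
        rw [hw, ← hc]
        exact spread_one_pow hn c x.1 i }
  exact ⟨⟨f, g, ⟨H.symm⟩, hfg ▸ .refl _⟩⟩
end

section
/- For every n ≥ 1, the set of path components of the ordered configuration space Conf(S¹,n) has cardinality (n-1)!. -/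
/-- If a continuous map to a discrete space has path connected fibres, then it identifies the set
of path components of its domain with its codomain. -/
theorem card_zerothHomotopy_of_isPathConnected_fiber {X I : Type*} [TopologicalSpace X]
    [TopologicalSpace I] [DiscreteTopology I] {p : X → I} (hp : Continuous p)
    (hfib : ∀ i, IsPathConnected (p ⁻¹' {i})) :
    Nat.card (ZerothHomotopy X) = Nat.card I := by
  have hlift : ∀ x y : X, Joined x y → p x = p y := fun x y ⟨γ⟩ => by
    have h := PreconnectedSpace.constant inferInstance (hp.comp γ.continuous) (x := 0) (y := 1)
    simpa using h
  refine Nat.card_congr (Equiv.ofBijective (Quotient.lift p hlift) ⟨?_, fun i => ?_⟩)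
  · rintro ⟨x⟩ ⟨y⟩ (h : p x = p y)
    exact Quotient.sound ((hfib (p y)).joinedIn x h y rfl).joined
  · obtain ⟨x, hx⟩ := (hfib i).nonempty
    exact ⟨Quotient.mk _ x, hx⟩

namespace Conf

open Real Topology

variable {m : ℕ}

theorem circle_exp_pi : Circle.exp π = -1 := by
  ext
  simp

/-- The angles, in `(-π, π)`, of the points of a configuration on the circle, measured from the
antipode of the point with index `0`. -/
noncomputable def angle (f : Conf Circle (m + 1)) (i : Fin m) : ℝ :=
  Complex.arg (-(f.1 i.succ / f.1 0) : Circle)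

theorem neg_exp_angle_mul (f : Conf Circle (m + 1)) (i : Fin m) :
    -Circle.exp (angle f i) * f.1 0 = f.1 i.succ := by
  rw [angle, Circle.exp_arg, neg_neg, div_mul_cancel]

theorem neg_div_ne_neg_one (f : Conf Circle (m + 1)) (i : Fin m) :
    -(f.1 i.succ / f.1 0) ≠ -1 := by
  rw [ne_eq, neg_inj, div_eq_one]
  exact fun h => Fin.succ_ne_zero i (f.2 h)

theorem angle_ne_pi (f : Conf Circle (m + 1)) (i : Fin m) : angle f i ≠ π := by
  intro h
  apply neg_div_ne_neg_one f i
  rw [← Circle.exp_arg (-(f.1 i.succ / f.1 0)), ← angle, h, circle_exp_pi]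

theorem angle_mem_Ioo (f : Conf Circle (m + 1)) (i : Fin m) : angle f i ∈ Set.Ioo (-π) π :=
  ⟨Complex.neg_pi_lt_arg _, (Complex.arg_le_pi _).lt_of_ne (angle_ne_pi f i)⟩

theorem angle_injective (f : Conf Circle (m + 1)) : Function.Injective (angle f) := by
  intro i j h
  apply Fin.succ_injective m
  apply f.2
  rw [← neg_exp_angle_mul, ← neg_exp_angle_mul, h]

theorem continuous_angle : Continuous (angle : Conf Circle (m + 1) → Fin m → ℝ) := by
  refine continuous_pi fun i => continuous_iff_continuousAt.2 fun f => ?_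
  have hslit : ((-(f.1 i.succ / f.1 0) : Circle) : ℂ) ∈ Complex.slitPlane :=
    Complex.mem_slitPlane_iff_arg.2 ⟨angle_ne_pi f i, Circle.coe_ne_zero _⟩
  refine ContinuousAt.comp (f := fun g : Conf Circle (m + 1) =>
    ((-(g.1 i.succ / g.1 0) : Circle) : ℂ)) (Complex.continuousAt_arg hslit) ?_
  have hsucc : Continuous fun g : Conf Circle (m + 1) => g.1 i.succ :=
    (continuous_apply i.succ).comp continuous_subtype_val
  have hzero : Continuous fun g : Conf Circle (m + 1) => g.1 0 :=
    (continuous_apply 0).comp continuous_subtype_val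
  exact (continuous_subtype_val.comp (hsucc.div' hzero).neg).continuousAt

/-- The tuple of points on the circle with a given point of index `0` and given angles. -/
noncomputable def ofAngle (p : Circle × (Fin m → ℝ)) : Fin (m + 1) → Circle :=
  Fin.cons p.1 fun i => -Circle.exp (p.2 i) * p.1

theorem continuous_ofAngle : Continuous (ofAngle (m := m)) := by
  refine continuous_pi fun i => ?_
  cases i using Fin.cases with
  | zero => exact continuous_fst
  | succ i =>
    simp only [ofAngle, Fin.cons_succ]
    fun_prop

theorem ofAngle_injective (z : Circle) {x : Fin m → ℝ} (hx : ∀ i, x i ∈ Set.Ioo (-π) π)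
    (hinj : Function.Injective x) : Function.Injective (ofAngle (z, x)) := by
  refine Fin.cons_injective_iff.2 ⟨?_, fun i j h => hinj ?_⟩
  · rintro ⟨i, hi⟩
    have h : Circle.exp (x i) = Circle.exp π := by
      rw [circle_exp_pi, ← neg_eq_iff_eq_neg]
      exact mul_eq_right.1 hi
    have h' := congrArg (fun w : Circle => Complex.arg w) h
    simp only [Circle.arg_exp (hx i).1 (hx i).2.le,
      Circle.arg_exp (neg_lt_self pi_pos) le_rfl] at h'
    exact (hx i).2.ne h'
  · have h : Circle.exp (x i) = Circle.exp (x j) := neg_injective (mul_right_cancel h)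
    rw [← Circle.arg_exp (hx i).1 (hx i).2.le, h, Circle.arg_exp (hx j).1 (hx j).2.le]

theorem angle_ofAngle (z : Circle) {x : Fin m → ℝ} (hx : ∀ i, x i ∈ Set.Ioo (-π) π)
    (hinj : Function.Injective (ofAngle (z, x))) : angle ⟨ofAngle (z, x), hinj⟩ = x := by
  ext i
  rw [angle]
  simp only [ofAngle, Fin.cons_succ, Fin.cons_zero, mul_div_cancel_right, neg_neg]
  exact Circle.arg_exp (hx i).1 (hx i).2.le

/-- The tuples of angles in `(-π, π)` sorted strictly by `σ`. -/
def sortedAngles (σ : Equiv.Perm (Fin m)) : Set (Fin m → ℝ) :=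
  {x | (∀ i, x i ∈ Set.Ioo (-π) π) ∧ StrictMono (x ∘ σ)}

theorem convex_sortedAngles (σ : Equiv.Perm (Fin m)) : Convex ℝ (sortedAngles σ) := by
  rintro x ⟨hx, hxσ⟩ y ⟨hy, hyσ⟩ a b ha hb hab
  refine ⟨fun i => convex_Ioo (-π) π (hx i) (hy i) ha hb hab, fun i j hij => ?_⟩
  have h₁ := hxσ hij
  have h₂ := hyσ hij
  simp only [Function.comp_apply, Pi.add_apply, Pi.smul_apply, smul_eq_mul] at h₁ h₂ ⊢
  rcases ha.eq_or_lt with rfl | ha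
  · obtain rfl : b = 1 := by linarith
    linarith
  · nlinarith [mul_lt_mul_of_pos_left h₁ ha, mul_le_mul_of_nonneg_left h₂.le hb]

theorem sortedAngles_nonempty (σ : Equiv.Perm (Fin m)) : (sortedAngles σ).Nonempty := by
  refine ⟨fun i => ((σ.symm i : ℕ) : ℝ) / m, fun i => ⟨?_, ?_⟩, fun i j hij => ?_⟩
  · exact (neg_lt_zero.2 pi_pos).trans_le (by positivity)
  · refine lt_of_le_of_lt (div_le_one_of_le₀ ?_ (Nat.cast_nonneg m)) (by linarith [pi_gt_three])
    exact_mod_cast (σ.symm i).2.le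
  · have hm : (0 : ℝ) < m := by exact_mod_cast i.pos
    have hij' : ((i : ℕ) : ℝ) < (j : ℕ) := by exact_mod_cast hij
    simpa using div_lt_div_of_pos_right hij' hm

theorem sort_angle_eq_iff (f : Conf Circle (m + 1)) (σ : Equiv.Perm (Fin m)) :
    Tuple.sort (angle f) = σ ↔ StrictMono (angle f ∘ σ) := by
  have hinj := (angle_injective f).comp σ.injective
  rw [eq_comm, Tuple.eq_sort_iff]
  exact ⟨fun h => h.1.strictMono_of_injective hinj,
    fun h => ⟨h.monotone, fun i j hij he => (hij.ne (hinj he)).elim⟩⟩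

theorem isOpen_sort_angle_eq (σ : Equiv.Perm (Fin m)) :
    IsOpen {f : Conf Circle (m + 1) | Tuple.sort (angle f) = σ} := by
  simp only [sort_angle_eq_iff, StrictMono, Set.ofPred_forall, Function.comp_apply]
  refine isOpen_iInter_of_finite fun i => isOpen_iInter_of_finite fun j =>
    isOpen_iInter_of_finite fun _ => isOpen_lt ?_ ?_
  · exact (continuous_apply (σ i)).comp continuous_angle
  · exact (continuous_apply (σ j)).comp continuous_angle

theorem isPathConnected_sort_angle_eq (σ : Equiv.Perm (Fin m)) :
    IsPathConnected {f : Conf Circle (m + 1) | Tuple.sort (angle f) = σ} := by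
  have himage : Subtype.val '' {f : Conf Circle (m + 1) | Tuple.sort (angle f) = σ} =
      ofAngle '' (Set.univ ×ˢ sortedAngles σ) := by
    ext g
    constructor
    · rintro ⟨f, hf, rfl⟩
      refine ⟨(f.1 0, angle f), ⟨trivial, angle_mem_Ioo f, (sort_angle_eq_iff f σ).1 hf⟩, ?_⟩
      ext1 i
      cases i using Fin.cases with
      | zero => rfl
      | succ i => exact neg_exp_angle_mul f i
    · rintro ⟨⟨z, x⟩, ⟨-, hx, hxσ⟩, rfl⟩
      have hxinj : Function.Injective x := σ.injective_comp x |>.1 hxσ.injective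
      have hinj := ofAngle_injective z hx hxinj
      refine ⟨⟨_, hinj⟩, (sort_angle_eq_iff _ σ).2 ?_, rfl⟩
      rwa [angle_ofAngle z hx hinj]
  have hval : IsInducing (Subtype.val : Conf Circle (m + 1) → Fin (m + 1) → Circle) := ⟨rfl⟩
  rw [hval.isPathConnected_iff, himage]
  exact (isPathConnected_univ.prod
    ((convex_sortedAngles σ).isPathConnected (sortedAngles_nonempty σ))).image continuous_ofAngle

end Conf

/-- The set of path components of the ordered configuration space of the circle has
cardinality `(n-1)!`. -/
theorem stmt5 (n : ℕ) (hn : 1 ≤ n) :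
    Nat.card (ZerothHomotopy (Conf Circle n)) = Nat.factorial (n - 1) := by
  obtain ⟨m, rfl⟩ := Nat.exists_eq_add_of_le' hn
  let _ : TopologicalSpace (Equiv.Perm (Fin m)) := ⊥
  have _ : DiscreteTopology (Equiv.Perm (Fin m)) := ⟨rfl⟩
  rw [card_zerothHomotopy_of_isPathConnected_fiber
    (p := fun f : Conf Circle (m + 1) => Tuple.sort (Conf.angle f))
    (continuous_discrete_rng.2 Conf.isOpen_sort_angle_eq) Conf.isPathConnected_sort_angle_eq]
  rw [Nat.card_perm, Nat.card_fin, Nat.add_sub_cancel]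
end

section
/- Let n ≥ 2 and let γ : [0,1] → Conf(S¹,n) be a continuous path in the ordered configuration space of the circle such that γ(1) = γ(0) ∘ σ for some permutation σ ∈ Equiv.Perm (Fin n). Then there exists a permutation c ∈ Equiv.Perm (Fin n) which is a cycle whose support is all of Fin n (an n-cycle), and an integer k, such that σ = c^k. (Equivalently, the monodromy of any loop in UConf(S¹,n) lies in a cyclic subgroup of Σ_n generated by an n-cycle.) -/
/-- Two continuous real functions on a preconnected space that never agree do not change order. -/
theorem lt_of_lt_of_forall_ne {X : Type*} [TopologicalSpace X] [PreconnectedSpace X]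
    {f g : X → ℝ} (hf : Continuous f) (hg : Continuous g) (hne : ∀ x, f x ≠ g x)
    {a b : X} (hab : f a < g a) : f b < g b := by
  by_contra! h
  obtain ⟨x, hx⟩ := intermediate_value_univ₂ (a := a) (b := b) hf hg hab.le h
  exact hne x hx

/-- A path in the circle lifts to a path in `ℝ` which starts at the principal argument. -/
theorem Circle.exists_continuous_lift {g : unitInterval → Circle} (hg : Continuous g) :
    ∃ θ : unitInterval → ℝ, Continuous θ ∧ (∀ t, Circle.exp (θ t) = g t) ∧
      θ 0 = Complex.arg (g 0 : ℂ) := by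
  obtain ⟨Γ, hΓ, hΓ0⟩ := Circle.isCoveringMap_exp.exists_path_lifts ⟨g, hg⟩
    (Complex.arg (g 0 : ℂ)) (Circle.exp_arg _).symm
  exact ⟨Γ, Γ.continuous, fun t => congrFun hΓ t, hΓ0⟩

/-- A strictly monotone surjection of `ℤ` is a translation. -/
theorem Int.apply_eq_add_of_strictMono_of_surjective {f : ℤ → ℤ} (hf : StrictMono f)
    (hs : Function.Surjective f) (z : ℤ) : f z = z + f 0 := by
  have hsucc : ∀ z, f (z + 1) = f z + 1 := fun z => by
    simpa using (hf.orderIsoOfSurjective f hs).map_succ z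
  induction z with
  | zero => simp
  | succ i ih => rw [hsucc, ih]; ring
  | pred i ih =>
    have := hsucc (-i - 1)
    rw [sub_add_cancel] at this
    linarith

/-- Going from `z` to `z + 1` rotates the remainder modulo `n`, and the quotient increases
exactly when the remainder wraps around. -/
theorem Int.divModEquiv_add_one (n : ℕ) (z : ℤ) :
    (Int.divModEquiv (n + 1) (z + 1)).2 = finRotate (n + 1) (Int.divModEquiv (n + 1) z).2 ∧
      (Int.divModEquiv (n + 1) (z + 1)).1 = (Int.divModEquiv (n + 1) z).1 +
        if (Int.divModEquiv (n + 1) z).2 = Fin.last n then 1 else 0 := by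
  obtain ⟨⟨q, r⟩, rfl⟩ := (Int.divModEquiv (n + 1)).symm.surjective z
  suffices h : Int.divModEquiv (n + 1) ((Int.divModEquiv (n + 1)).symm (q, r) + 1) =
      (q + if r = Fin.last n then 1 else 0, finRotate (n + 1) r) by
    rw [h, Equiv.apply_symm_apply]
    exact ⟨rfl, rfl⟩
  rw [← Equiv.eq_symm_apply]
  simp only [Int.divModEquiv_symm_apply]
  split_ifs with hr
  · subst hr
    simp
    ring
  · rw [coe_finRotate_of_ne_last hr]
    push_cast
    ring

theorem finRotate_zpow_divModEquiv (n : ℕ) (z k : ℤ) :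
    (finRotate (n + 1) ^ k) (Int.divModEquiv (n + 1) z).2 =
      (Int.divModEquiv (n + 1) (z + k)).2 := by
  induction k with
  | zero => simp
  | succ i ih =>
    rw [add_comm (i : ℤ) 1, zpow_one_add, Equiv.Perm.mul_apply, ih,
      ← (Int.divModEquiv_add_one n _).1]
    ring_nf
  | pred i ih =>
    rw [sub_eq_neg_add, zpow_add, zpow_neg_one, Equiv.Perm.mul_apply, ih, Equiv.Perm.inv_eq_iff_eq,
      ← (Int.divModEquiv_add_one n _).1]
    ring_nf

/-- The increasing `ℤ`-indexed enumeration of the `p`-periodic set generated by the increasing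
tuple `θ`. -/
theorem strictMono_divModEquiv_periodic {n : ℕ} {θ : Fin (n + 1) → ℝ} {p : ℝ} (hθ : StrictMono θ)
    (hp : ∀ i j, θ i < θ j + p) :
    StrictMono fun z : ℤ =>
      θ (Int.divModEquiv (n + 1) z).2 + (Int.divModEquiv (n + 1) z).1 * p := by
  refine strictMono_int_of_lt_succ fun z => ?_
  obtain ⟨h2, h1⟩ := Int.divModEquiv_add_one n z
  simp only [h1, h2]
  generalize Int.divModEquiv (n + 1) z = w
  split_ifs with h
  · have := hp w.2 (finRotate (n + 1) w.2)
    push_cast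
    linarith
  · have : θ w.2 < θ (finRotate (n + 1) w.2) := hθ <| by
      rw [Fin.lt_def, coe_finRotate_of_ne_last h]
      exact Nat.lt_succ_self _
    simpa using this

/-- If two `p`-periodic families of reals are in the same order and `σ` identifies them modulo `p`,
then `σ` is a power of a full cycle. -/
theorem exists_isCycle_zpow_of_periodic {n : ℕ} (hn : 1 ≤ n) {θ η : Fin (n + 1) → ℝ} {p : ℝ}
    (hinj : Function.Injective θ) (hp : ∀ i j, θ i < θ j + p)
    (hlt : ∀ i j, ∀ a b : ℤ, θ i + a * p < θ j + b * p → η i + a * p < η j + b * p)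
    (σ : Equiv.Perm (Fin (n + 1))) (hσ : ∀ i, ∃ m : ℤ, η i = θ (σ i) + m * p) :
    ∃ c : Equiv.Perm (Fin (n + 1)),
      c.IsCycle ∧ c.support = Finset.univ ∧ ∃ k : ℤ, σ = c ^ k := by
  choose m hm using hσ
  let s := Tuple.sort θ
  have hs : StrictMono (θ ∘ s) :=
    (Tuple.monotone_sort θ).strictMono_of_injective (hinj.comp s.injective)
  let E := Int.divModEquiv (n + 1)
  let a : ℤ → ℝ := fun z => θ (s (E z).2) + (E z).1 * p
  let b : ℤ → ℝ := fun z => η (s (E z).2) + (E z).1 * p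
  have ha : StrictMono a := strictMono_divModEquiv_periodic hs fun i j => hp _ _
  have hb : StrictMono b := fun z w hzw => hlt _ _ _ _ (ha hzw)
  let f : ℤ → ℤ := fun z => E.symm ((E z).1 + m (s (E z).2), s⁻¹ (σ (s (E z).2)))
  have haf : ∀ z, a (f z) = b z := fun z => by
    simp only [a, b, f, Equiv.Perm.coe_inv, Equiv.apply_symm_apply, hm]
    push_cast
    ring
  have hf : StrictMono f := fun z w hzw => by
    rw [← ha.lt_iff_lt, haf, haf]
    exact hb hzw
  have hsurj : Function.Surjective f := fun w => by
    refine ⟨E.symm ((E w).1 - m (σ⁻¹ (s (E w).2)), s⁻¹ (σ⁻¹ (s (E w).2))), ?_⟩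
    simp [f]
  refine ⟨s * finRotate (n + 1) * s⁻¹, (isCycle_finRotate_of_le (by omega)).conj, ?_, f 0, ?_⟩
  · rw [Equiv.Perm.support_conj, support_finRotate_of_le (by omega), Finset.map_univ_equiv]
  · rw [conj_zpow]
    ext1 i
    obtain ⟨z, hz⟩ : ∃ z, s (E z).2 = i := ⟨E.symm (0, s⁻¹ i), by simp⟩
    have h := congrArg (fun w => s (E w).2)
      (Int.apply_eq_add_of_strictMono_of_surjective hf hsurj z)
    simp only [f, Equiv.Perm.coe_inv, Equiv.apply_symm_apply] at h
    rw [Equiv.Perm.mul_apply, Equiv.Perm.mul_apply, ← hz, Equiv.Perm.coe_inv, Equiv.symm_apply_apply,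
      finRotate_zpow_divModEquiv]
    exact h

/-- The monodromy of any loop in the unordered configuration space of the circle is a power
of an `n`-cycle. -/
theorem stmt7 (n : ℕ) (hn : 2 ≤ n) (γ : unitInterval → Conf Circle n)
    (hγ : Continuous γ) (σ : Equiv.Perm (Fin n))
    (hloop : (γ 1).1 = (γ 0).1 ∘ ⇑σ) :
    ∃ c : Equiv.Perm (Fin n), c.IsCycle ∧ c.support = Finset.univ ∧ ∃ k : ℤ, σ = c ^ k := by
  obtain ⟨n, rfl⟩ : ∃ k, n = k + 1 := ⟨n - 1, by omega⟩
  have hγi : ∀ i, Continuous fun t => (γ t).1 i := fun i =>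
    (continuous_apply i).comp (continuous_subtype_val.comp hγ)
  choose θ hθc hθ hθ0 using fun i => Circle.exists_continuous_lift (hγi i)
  refine exists_isCycle_zpow_of_periodic (θ := fun i => θ i 0) (η := fun i => θ i 1)
    (p := 2 * Real.pi) (by omega) ?_ ?_ ?_ σ ?_
  · intro i j hij
    apply (γ 0).2
    rw [← hθ, ← hθ]
    exact congrArg _ hij
  · intro i j
    have h1 := Complex.arg_le_pi ((γ 0).1 i : ℂ)
    have h2 := Complex.neg_pi_lt_arg ((γ 0).1 j : ℂ)
    simp only [hθ0]
    linarith
  · intro i j a b hab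
    refine lt_of_lt_of_forall_ne (f := fun t => θ i t + a * (2 * Real.pi))
      (g := fun t => θ j t + b * (2 * Real.pi)) ((hθc i).add_const _) ((hθc j).add_const _)
      (fun t ht => ?_) hab
    have hij : i = j := by
      apply (γ t).2
      rw [← hθ, ← hθ, Circle.exp_eq_exp]
      refine ⟨b - a, ?_⟩
      push_cast
      linarith
    subst hij
    linarith
  · intro i
    rw [← Circle.exp_eq_exp, hθ, hθ]
    exact congrFun hloop i
end

section
/- Let n be an odd natural number with n ≥ 1, and let γ : [0,1] → Conf(S¹,n) be a continuous path in the ordered configuration space of the circle such that γ(1) = γ(0) ∘ σ for some permutation σ ∈ Equiv.Perm (Fin n). Then sign(σ) = 1, i.e. σ is an even permutation. (This expresses that the first Stiefel–Whitney class of the canonical bundle ξ_{S¹,n} vanishes for odd n.) -/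
open Matrix in
/-- The Vandermonde determinant changes by the sign of a permutation of its nodes. -/
lemma det_vandermonde_comp_perm {R : Type*} [CommRing R] {n : ℕ} (v : Fin n → R)
    (σ : Equiv.Perm (Fin n)) :
    (vandermonde (v ∘ σ)).det = (Equiv.Perm.sign σ : ℤ) * (vandermonde v).det := by
  rw [← det_permute σ (vandermonde v)]
  rfl

/-- The Vandermonde determinant of `2 * m + 1` points on the unit circle, divided by the `m`-th
power of the product of the points. -/
noncomputable def circleVandermonde (m : ℕ) (z : Fin (2 * m + 1) → Circle) : ℂ :=
  (Matrix.vandermonde fun i => (z i : ℂ)).det * ∏ i, (starRingEnd ℂ (z i)) ^ m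

lemma continuous_circleVandermonde (m : ℕ) : Continuous (circleVandermonde m) := by
  unfold circleVandermonde
  simp only [Matrix.det_vandermonde]
  fun_prop

lemma circleVandermonde_ne_zero {m : ℕ} {z : Fin (2 * m + 1) → Circle}
    (hz : Function.Injective z) : circleVandermonde m z ≠ 0 :=
  mul_ne_zero (Matrix.det_vandermonde_ne_zero_iff.2 (Subtype.val_injective.comp hz))
    (Finset.prod_ne_zero_iff.2 fun _ _ => pow_ne_zero _ (by simp))

lemma circleVandermonde_comp_perm {m : ℕ} (z : Fin (2 * m + 1) → Circle)
    (σ : Equiv.Perm (Fin (2 * m + 1))) :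
    circleVandermonde m (z ∘ σ) = (Equiv.Perm.sign σ : ℤ) * circleVandermonde m z := by
  unfold circleVandermonde
  rw [← mul_assoc, ← det_vandermonde_comp_perm]
  congr 1
  exact Equiv.prod_comp σ fun i => (starRingEnd ℂ (z i)) ^ m

/-- Up to a sign depending only on `m`, `circleVandermonde m` is invariant under conjugation. -/
lemma conj_circleVandermonde {m : ℕ} (z : Fin (2 * m + 1) → Circle) :
    starRingEnd ℂ (circleVandermonde m z) =
      (Equiv.Perm.sign (Fin.revPerm (n := 2 * m + 1)) : ℤ) * circleVandermonde m z := by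
  have hconj (i) : starRingEnd ℂ (z i) * (z i : ℂ) = 1 := by
    rw [mul_comm, Complex.mul_conj, Circle.normSq_coe, Complex.ofReal_one]
  have hdet : starRingEnd ℂ (Matrix.vandermonde fun i => (z i : ℂ)).det =
      (∏ i, (starRingEnd ℂ (z i)) ^ (2 * m)) *
        ((Equiv.Perm.sign (Fin.revPerm (n := 2 * m + 1)) : ℤ) *
          (Matrix.vandermonde fun i => (z i : ℂ)).det) := by
    rw [← Matrix.det_permute', ← Matrix.det_mul_column, RingHom.map_det]
    congr 1
    ext i j
    have hpow : (starRingEnd ℂ (z i)) ^ (2 * m) =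
        (starRingEnd ℂ (z i)) ^ (j : ℕ) * (starRingEnd ℂ (z i)) ^ (2 * m - j) := by
      rw [← pow_add]
      congr 1
      lia
    have hrev : ((Fin.rev j : Fin (2 * m + 1)) : ℕ) = 2 * m - j := by
      rw [Fin.val_rev]; lia
    simp only [RingHom.mapMatrix_apply, Matrix.map_apply, Matrix.vandermonde_apply, map_pow,
      Matrix.of_apply, Matrix.submatrix_apply, id, Fin.revPerm_apply, hrev]
    rw [hpow, mul_assoc, ← mul_pow, hconj, one_pow, mul_one]
  have hprod : (∏ i, (starRingEnd ℂ (z i)) ^ (2 * m)) * ∏ i, (z i : ℂ) ^ m =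
      ∏ i, (starRingEnd ℂ (z i)) ^ m := by
    rw [← Finset.prod_mul_distrib]
    refine Finset.prod_congr rfl fun i _ => ?_
    rw [two_mul, pow_add, mul_assoc, ← mul_pow, hconj, one_pow, mul_one]
  simp only [circleVandermonde, map_mul, map_prod, map_pow, Complex.conj_conj]
  rw [hdet, ← hprod]
  ring

/-- For odd `n`, the monodromy of any loop in the unordered configuration space of the
circle is an even permutation. -/
theorem stmt8 (n : ℕ) (hn : 1 ≤ n) (hodd : Odd n) (γ : unitInterval → Conf Circle n)
    (hγ : Continuous γ) (σ : Equiv.Perm (Fin n))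
    (hloop : (γ 1).1 = (γ 0).1 ∘ ⇑σ) :
    Equiv.Perm.sign σ = 1 := by
  obtain ⟨m, rfl⟩ := hodd
  set F : unitInterval → ℂ := fun t => circleVandermonde m (γ t).1 with hF
  have hF_cont : Continuous F :=
    (continuous_circleVandermonde m).comp (continuous_subtype_val.comp hγ)
  have hF_ne (t) : F t ≠ 0 := circleVandermonde_ne_zero (γ t).2
  have hreal (t) : ((F t / F 0).re : ℂ) = F t / F 0 := by
    rw [← Complex.conj_eq_iff_re, map_div₀]
    simp only [hF, conj_circleVandermonde]
    exact mul_div_mul_left _ _ (by simp)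
  refine (Int.units_eq_one_or _).resolve_right fun hσ => ?_
  have h_one : F 1 / F 0 = -1 := by
    rw [div_eq_iff (hF_ne 0)]
    simp only [hF, hloop, circleVandermonde_comp_perm, hσ]
    simp
  have hg : Continuous fun t => (F t / F 0).re := by fun_prop
  obtain ⟨t, ht⟩ := mem_range_of_exists_le_of_exists_ge hg (c := 0)
    ⟨1, by simp [h_one]⟩ ⟨0, by simp [div_self (hF_ne 0)]⟩
  refine div_ne_zero (hF_ne t) (hF_ne 0) ?_
  rw [← hreal t]
  exact_mod_cast ht
end

section
/- Let n be an even natural number with n ≥ 2. Then there exist an injective map f : Fin n → S¹, a permutation σ ∈ Equiv.Perm (Fin n) with sign(σ) = -1, and a continuous path γ : [0,1] → Conf(S¹,n) with γ(0) = f and γ(1) = f ∘ σ. (This expresses that the first Stiefel–Whitney class of the canonical bundle ξ_{S¹,n} is nonzero for even n.) -/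
/-- Rotating the `n`-th roots of unity on the circle by the angle `2πt / n`. -/
noncomputable def rotatedRootsOfUnity (n : ℕ) (t : ℝ) (k : Fin n) : Circle :=
  Circle.exp (2 * Real.pi * ((k : ℝ) + t) / n)

theorem rotatedRootsOfUnity_injective (n : ℕ) (t : ℝ) :
    Function.Injective (rotatedRootsOfUnity n t) := by
  intro j k h
  have hn : (n : ℝ) ≠ 0 := Nat.cast_ne_zero.2 (Fin.pos j).ne'
  obtain ⟨m, hm⟩ := Circle.exp_eq_exp.1 h
  have hπ := Real.pi_ne_zero
  field_simp at hm
  have hjk : (j : ℤ) = k + n * m := by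
    have : (j : ℝ) = k + n * m := by linarith
    exact_mod_cast this
  have hmod := congrArg (· % (n : ℤ)) hjk
  simp only [Int.add_mul_emod_self_left] at hmod
  norm_cast at hmod
  rw [Nat.mod_eq_of_lt j.isLt, Nat.mod_eq_of_lt k.isLt] at hmod
  exact Fin.ext hmod

theorem continuous_rotatedRootsOfUnity (n : ℕ) : Continuous (rotatedRootsOfUnity n) := by
  unfold rotatedRootsOfUnity
  fun_prop

theorem rotatedRootsOfUnity_one (n : ℕ) :
    rotatedRootsOfUnity n 1 = rotatedRootsOfUnity n 0 ∘ finRotate n := by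
  cases n with
  | zero => exact Subsingleton.elim _ _
  | succ n =>
    ext1 k
    rcases eq_or_ne k (Fin.last n) with rfl | hk
    · have hn : (n : ℝ) + 1 ≠ 0 := by positivity
      simp [rotatedRootsOfUnity, hn]
    · simp only [rotatedRootsOfUnity, Function.comp_apply, coe_finRotate_of_ne_last hk,
        Nat.cast_add, Nat.cast_one, add_zero]

/-- For even `n ≥ 2`, there is a loop in the unordered configuration space of the circle
whose monodromy is an odd permutation. -/
theorem stmt9 (n : ℕ) (hn : 2 ≤ n) (heven : Even n) :
    ∃ (f : Conf Circle n) (σ : Equiv.Perm (Fin n)) (γ : unitInterval → Conf Circle n),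
      Continuous γ ∧ Equiv.Perm.sign σ = -1 ∧ γ 0 = f ∧ (γ 1).1 = f.1 ∘ ⇑σ := by
  refine ⟨⟨_, rotatedRootsOfUnity_injective n 0⟩, finRotate n,
    fun t ↦ ⟨_, rotatedRootsOfUnity_injective n t⟩, ?_, ?_, rfl, rotatedRootsOfUnity_one n⟩
  · exact ((continuous_rotatedRootsOfUnity n).comp continuous_subtype_val).subtype_mk _
  · rw [sign_finRotate]
    exact (Nat.Even.sub_odd (by lia) heven odd_one).neg_one_pow
end

section
/- The ordered configuration space Conf(K₅,2) of two distinct points on the complete graph K₅ is path-connected. (This is the connectivity of the double cover Conf(K₅,2) → UConf(K₅,2), expressing that the first Stiefel–Whitney class of the canonical bundle ξ_{K₅,2} is nonzero; it follows from the identification of this space with a closed orientable surface of genus 6.) -/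
/-- A geometric realization of the complete graph on five vertices: the union in `ℝ⁵` of the
closed segments joining distinct standard basis vectors. -/
def K5 : Set (Fin 5 → ℝ) :=
  ⋃ (i : Fin 5) (j : Fin 5) (_ : i ≠ j),
    segment ℝ (Pi.single i (1 : ℝ)) (Pi.single j (1 : ℝ))

/-- The configuration space of two points is path-connected as soon as the complement of every
point is path-connected and any two points can be avoided simultaneously. -/
theorem pathConnectedSpace_conf_two {X : Type*} [TopologicalSpace X] [Nonempty X]
    (hX : ∀ p x y : X, x ≠ p → y ≠ p → JoinedIn {p}ᶜ x y)
    (hz : ∀ x y : X, ∃ z, z ≠ x ∧ z ≠ y) : PathConnectedSpace (Conf X 2) := by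
  let c : ∀ x y : X, x ≠ y → Conf X 2 := fun x y h ↦ ⟨![x, y], by
    intro i j
    fin_cases i <;> fin_cases j <;> simp [h, h.symm]⟩
  have hc : ∀ f : Conf X 2, ∃ x y h, f = c x y h := fun f ↦
    ⟨f.1 0, f.1 1, f.2.ne (by decide), Subtype.ext (by ext i; fin_cases i <;> rfl)⟩
  have move_fst : ∀ x x' y (h : x ≠ y) (h' : x' ≠ y), Joined (c x y h) (c x' y h') := by
    intro x x' y h h'
    have hf : Continuous fun t : ({y}ᶜ : Set X) ↦ c t y t.2 := by
      refine Continuous.subtype_mk (continuous_pi fun i ↦ ?_) _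
      fin_cases i
      · exact continuous_subtype_val
      · exact continuous_const
    exact (joinedIn_iff_joined h h').1 (hX y x x' h h') |>.map hf
  have move_snd : ∀ x y y' (h : x ≠ y) (h' : x ≠ y'), Joined (c x y h) (c x y' h') := by
    intro x y y' h h'
    have hf : Continuous fun t : ({x}ᶜ : Set X) ↦ c x t (Ne.symm t.2) := by
      refine Continuous.subtype_mk (continuous_pi fun i ↦ ?_) _
      fin_cases i
      · exact continuous_const
      · exact continuous_subtype_val
    exact (joinedIn_iff_joined h.symm h'.symm).1 (hX x y y' h.symm h'.symm) |>.map hf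
  refine ⟨?_, fun f g ↦ ?_⟩
  · obtain ⟨x⟩ := ‹Nonempty X›
    obtain ⟨z, h, -⟩ := hz x x
    exact ⟨c z x h⟩
  · obtain ⟨x, y, h, rfl⟩ := hc f
    obtain ⟨x', y', h', rfl⟩ := hc g
    obtain ⟨z, hy, hy'⟩ := hz y y'
    exact ((move_fst x z y h hy).trans (move_snd z y y' hy hy')).trans (move_fst z x' y' hy' h')

theorem segment_subset_K5 {i j : Fin 5} (h : i ≠ j) :
    segment ℝ (Pi.single i (1 : ℝ)) (Pi.single j (1 : ℝ)) ⊆ K5 := fun _ hx ↦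
  Set.mem_iUnion.2 ⟨i, Set.mem_iUnion.2 ⟨j, Set.mem_iUnion.2 ⟨h, hx⟩⟩⟩

theorem single_mem_K5 (i : Fin 5) : (Pi.single i 1 : Fin 5 → ℝ) ∈ K5 := by
  obtain ⟨j, hj⟩ := exists_ne i
  exact segment_subset_K5 hj.symm (left_mem_segment ℝ _ _)

/-- A point lying between `x` and both endpoints of a segment through `x` is `x` itself. -/
theorem eq_of_mem_segment_of_mem_segment {E : Type*} [AddCommGroup E] [Module ℝ E]
    {u v x p : E} (hx : x ∈ segment ℝ u v) (hu : p ∈ segment ℝ x u) (hv : p ∈ segment ℝ x v) :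
    p = x := by
  rw [mem_segment_iff_wbtw] at hx hu hv
  exact (hx.trans_left_right hu.symm).swap_left_iff.1 hv

/-- A point of `segment e_i e_j` other than `e_i` has nonzero `j`-th coordinate. -/
theorem apply_ne_zero_of_mem_segment_single {ι : Type*} [DecidableEq ι] {i j : ι} {p : ι → ℝ}
    (hp : p ∈ segment ℝ (Pi.single i (1 : ℝ)) (Pi.single j (1 : ℝ)))
    (hij : i ≠ j) (h : p ≠ Pi.single i 1) : p j ≠ 0 := by
  obtain ⟨a, b, -, -, hab, rfl⟩ := hp
  intro h0
  have hb : b = 0 := by simpa [hij.symm] using h0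
  apply h
  simp [hb, show a = 1 by linarith]

theorem apply_eq_zero_of_mem_segment_single {ι : Type*} [DecidableEq ι] {i j k : ι} {p : ι → ℝ}
    (hp : p ∈ segment ℝ (Pi.single i (1 : ℝ)) (Pi.single j (1 : ℝ)))
    (hi : k ≠ i) (hj : k ≠ j) : p k = 0 := by
  obtain ⟨a, b, -, -, -, rfl⟩ := hp
  simp [hi, hj]

theorem joinedIn_K5_of_segment {p x y : Fin 5 → ℝ} (h : segment ℝ x y ⊆ K5)
    (hp : p ∉ segment ℝ x y) : JoinedIn (K5 \ {p}) x y :=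
  JoinedIn.of_segment_subset fun _ hz ↦ ⟨h hz, fun hzp ↦ hp (hzp ▸ hz)⟩

theorem joinedIn_K5_single {p : Fin 5 → ℝ} {i j : Fin 5} (hi : Pi.single i 1 ≠ p)
    (hj : Pi.single j 1 ≠ p) :
    JoinedIn (K5 \ {p}) (Pi.single i (1 : ℝ)) (Pi.single j (1 : ℝ)) := by
  obtain rfl | hij := eq_or_ne i j
  · exact JoinedIn.refl ⟨single_mem_K5 i, hi⟩
  by_cases hp : p ∈ segment ℝ (Pi.single i (1 : ℝ)) (Pi.single j (1 : ℝ))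
  · obtain ⟨k, hki, hkj⟩ : ∃ k, k ≠ i ∧ k ≠ j := by
      clear * -
      decide +revert
    have hpj := apply_ne_zero_of_mem_segment_single hp hij hi.symm
    have hpi := apply_ne_zero_of_mem_segment_single (by rwa [segment_symm]) hij.symm hj.symm
    exact (joinedIn_K5_of_segment (segment_subset_K5 hki.symm) fun h ↦
      hpj (apply_eq_zero_of_mem_segment_single h hij.symm hkj.symm)).trans
      (joinedIn_K5_of_segment (segment_subset_K5 hkj) fun h ↦
      hpi (apply_eq_zero_of_mem_segment_single h hki.symm hij))
  · exact joinedIn_K5_of_segment (segment_subset_K5 hij) hp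

theorem exists_joinedIn_K5_single {p x : Fin 5 → ℝ} (hx : x ∈ K5) (hxp : x ≠ p) :
    ∃ i, Pi.single i 1 ≠ p ∧ JoinedIn (K5 \ {p}) x (Pi.single i (1 : ℝ)) := by
  simp only [K5, Set.mem_iUnion] at hx
  obtain ⟨i, j, hij, hx⟩ := hx
  have key : ∀ k, segment ℝ x (Pi.single k (1 : ℝ)) ⊆ K5 → p ∉ segment ℝ x (Pi.single k (1 : ℝ)) →
      ∃ i, Pi.single i 1 ≠ p ∧ JoinedIn (K5 \ {p}) x (Pi.single i (1 : ℝ)) := fun k hk hp ↦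
    ⟨k, fun h ↦ hp (h ▸ right_mem_segment ℝ _ _), joinedIn_K5_of_segment hk hp⟩
  have hsub := segment_subset_K5 hij
  have hconv := convex_segment (𝕜 := ℝ) (Pi.single i (1 : ℝ) : Fin 5 → ℝ) (Pi.single j (1 : ℝ))
  by_cases hp : p ∈ segment ℝ x (Pi.single i (1 : ℝ))
  · exact key j ((hconv.segment_subset hx (right_mem_segment ℝ _ _)).trans hsub) fun h ↦
      hxp (eq_of_mem_segment_of_mem_segment hx hp h).symm
  · exact key i ((hconv.segment_subset hx (left_mem_segment ℝ _ _)).trans hsub) hp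

theorem joinedIn_K5_diff_singleton {p x y : Fin 5 → ℝ} (hx : x ∈ K5) (hy : y ∈ K5)
    (hxp : x ≠ p) (hyp : y ≠ p) : JoinedIn (K5 \ {p}) x y := by
  obtain ⟨i, hi, hxi⟩ := exists_joinedIn_K5_single hx hxp
  obtain ⟨j, hj, hyj⟩ := exists_joinedIn_K5_single hy hyp
  exact (hxi.trans (joinedIn_K5_single hi hj)).trans hyj.symm

/-- The ordered configuration space of two points on the complete graph `K₅` is
path-connected. -/
theorem stmt14 : PathConnectedSpace (Conf ↥K5 2) := by
  let v : Fin 5 → K5 := fun i ↦ ⟨Pi.single i 1, single_mem_K5 i⟩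
  have hv : Function.Injective v := fun i j h ↦ by
    simpa [v, Pi.single_apply] using congrFun (congrArg Subtype.val h) i
  have : Nonempty K5 := ⟨v 0⟩
  refine pathConnectedSpace_conf_two (fun p x y hx hy ↦ ?_) fun x y ↦ ?_
  · obtain ⟨γ, hγ⟩ := joinedIn_K5_diff_singleton x.2 y.2 (Subtype.coe_ne_coe.2 hx)
      (Subtype.coe_ne_coe.2 hy)
    exact ⟨⟨⟨fun t ↦ ⟨γ t, (hγ t).1⟩, by fun_prop⟩, Subtype.ext γ.source, Subtype.ext γ.target⟩,
      fun t h ↦ (hγ t).2 (congrArg Subtype.val h)⟩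
  · classical
    obtain ⟨z, hz, hzxy⟩ := Finset.exists_mem_notMem_of_card_lt_card
      (s := {x, y}) (t := Finset.univ.image v) (by
        rw [Finset.card_image_of_injective _ hv]
        exact Finset.card_le_two.trans_lt (by simp))
    exact ⟨z, by simpa using hzxy⟩
end

section
/- The ordered configuration space Conf(K₃,₃,2) of two distinct points on the complete bipartite graph K₃,₃ is path-connected. (This is the connectivity of the double cover Conf(K₃,₃,2) → UConf(K₃,₃,2), expressing that the first Stiefel–Whitney class of the canonical bundle ξ_{K₃,₃,2} is nonzero; it follows from the identification of this space with a closed orientable surface of genus 4.) -/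
/-- A geometric realization of the complete bipartite graph `K₃,₃`: the union in `ℝ⁶` of the
nine closed segments joining `eᵢ` (`i = 0,1,2`) to `e_{3+j}` (`j = 0,1,2`). -/
def K33 : Set (Fin 6 → ℝ) :=
  ⋃ (i : Fin 3) (j : Fin 3),
    segment ℝ (Pi.single (Fin.castAdd 3 i) (1 : ℝ)) (Pi.single (Fin.natAdd 3 j) (1 : ℝ))

open Set

/-- Ordered pairs of distinct points of `K33`, as a subset of the ambient product. -/
def K33OffDiag : Set ((Fin 6 → ℝ) × (Fin 6 → ℝ)) :=
  {p | p.1 ∈ K33 ∧ p.2 ∈ K33 ∧ p.1 ≠ p.2}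

theorem K33_subset_stdSimplex : K33 ⊆ stdSimplex ℝ (Fin 6) := by
  refine iUnion₂_subset fun i j => ?_
  exact (convex_stdSimplex ℝ (Fin 6)).segment_subset
    (single_mem_stdSimplex ℝ _) (single_mem_stdSimplex ℝ _)

theorem add_le_one_of_mem_stdSimplex {ι : Type*} [Fintype ι] {x : ι → ℝ}
    (hx : x ∈ stdSimplex ℝ ι) {a b : ι} (hab : a ≠ b) : x a + x b ≤ 1 := by
  classical
  rw [← hx.2, ← Finset.sum_pair hab]
  exact Finset.sum_le_sum_of_subset_of_nonneg (Finset.subset_univ _) fun i _ _ => hx.1 i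

theorem eq_single_of_mem_stdSimplex {ι : Type*} [Fintype ι] [DecidableEq ι] {x : ι → ℝ}
    (hx : x ∈ stdSimplex ℝ ι) {a : ι} (ha : 1 ≤ x a) : x = Pi.single a 1 := by
  ext b
  rcases eq_or_ne a b with rfl | hab
  · rw [Pi.single_eq_same]
    exact le_antisymm (hx.2 ▸ Finset.single_le_sum (fun i _ => hx.1 i) (Finset.mem_univ _)) ha
  · rw [Pi.single_eq_of_ne' hab]
    linarith [add_le_one_of_mem_stdSimplex hx hab, hx.1 b]

/-- Moving straight from `x` to the vertex `a` of the simplex increases the `a`-th coordinate. -/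
theorem eq_of_mem_segment_single {ι : Type*} [Fintype ι] [DecidableEq ι] {x y : ι → ℝ}
    (hx : x ∈ stdSimplex ℝ ι) {a : ι} (hy : y ∈ segment ℝ x (Pi.single a 1))
    (hle : y a ≤ x a) : x = y := by
  rw [segment_eq_image'] at hy
  obtain ⟨s, ⟨hs, -⟩, rfl⟩ := hy
  rcases hs.eq_or_lt with rfl | hs
  · simp
  · have h1 : 1 ≤ x a := by
      simp only [Pi.add_apply, Pi.smul_apply, Pi.sub_apply, Pi.single_eq_same, smul_eq_mul] at hle
      nlinarith
    rw [← eq_single_of_mem_stdSimplex hx h1]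
    simp

theorem joinedIn_move_fst {x y : Fin 6 → ℝ} (h : (x, y) ∈ K33OffDiag) {a : Fin 6}
    (hseg : segment ℝ x (Pi.single a 1) ⊆ K33) (hle : y a ≤ x a) :
    JoinedIn K33OffDiag (x, y) (Pi.single a 1, y) := by
  refine JoinedIn.of_segment_subset ?_
  rw [← Prod.image_mk_segment_left]
  rintro _ ⟨z, hz, rfl⟩
  refine ⟨hseg hz, h.2.1, ?_⟩
  intro (hzy : z = y)
  subst hzy
  exact h.2.2 (eq_of_mem_segment_single (K33_subset_stdSimplex h.1) hz hle)

theorem joinedIn_move_snd {x y : Fin 6 → ℝ} (h : (x, y) ∈ K33OffDiag) {a : Fin 6}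
    (hseg : segment ℝ y (Pi.single a 1) ⊆ K33) (hle : x a ≤ y a) :
    JoinedIn K33OffDiag (x, y) (x, Pi.single a 1) := by
  refine JoinedIn.of_segment_subset ?_
  rw [← Prod.image_mk_segment_right]
  rintro _ ⟨z, hz, rfl⟩
  refine ⟨h.1, hseg hz, ?_⟩
  intro (hxz : x = z)
  subst hxz
  exact h.2.2 (eq_of_mem_segment_single (K33_subset_stdSimplex h.2.1) hz hle).symm

theorem segment_single_subset_K33 {a b : Fin 6} (h : a < 3 ↔ ¬ b < 3) :
    segment ℝ (Pi.single a (1 : ℝ)) (Pi.single b 1) ⊆ K33 := by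
  have key : ∀ a b : Fin 6, a < 3 → ¬ b < 3 →
      segment ℝ (Pi.single a (1 : ℝ)) (Pi.single b 1) ⊆ K33 := by
    intro a b ha hb
    obtain ⟨i, rfl⟩ : ∃ i : Fin 3, Fin.castAdd 3 i = a := by revert a; decide
    obtain ⟨j, rfl⟩ : ∃ j : Fin 3, Fin.natAdd 3 j = b := by revert b; decide
    exact subset_iUnion₂ (s := fun i j : Fin 3 => segment ℝ
      (Pi.single (Fin.castAdd 3 i) (1 : ℝ)) (Pi.single (Fin.natAdd 3 j) (1 : ℝ))) i j
  by_cases ha : a < 3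
  · exact key a b ha (h.1 ha)
  · rw [segment_symm]
    exact key b a (by tauto) ha

/-- The first of two points of `K33` lies on an edge with an endpoint `a` for which it has the
larger `a`-th coordinate. -/
theorem exists_vertex_move {x y : Fin 6 → ℝ} (hx : x ∈ K33) (hy : y ∈ K33) :
    ∃ a : Fin 6, segment ℝ x (Pi.single a 1) ⊆ K33 ∧ y a ≤ x a := by
  obtain ⟨i, j, hxs⟩ := mem_iUnion₂.1 hx
  have hne : Fin.castAdd 3 i ≠ Fin.natAdd 3 j := by clear hxs; revert i j; decide
  have hsub : segment ℝ (Pi.single (Fin.castAdd 3 i) (1 : ℝ)) (Pi.single (Fin.natAdd 3 j) 1)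
      ⊆ K33 := segment_single_subset_K33 (by clear hxs hne; revert i j; decide)
  have hconv := convex_segment (𝕜 := ℝ) (Pi.single (Fin.castAdd 3 i) 1 : Fin 6 → ℝ)
    (Pi.single (Fin.natAdd 3 j) 1)
  have hsum : x (Fin.castAdd 3 i) + x (Fin.natAdd 3 j) = 1 := by
    obtain ⟨s, t, -, -, hst, rfl⟩ := hxs
    simpa [-Fin.natAdd_eq_addNat, Pi.single_eq_of_ne hne, Pi.single_eq_of_ne' hne] using hst
  have hle := add_le_one_of_mem_stdSimplex (K33_subset_stdSimplex hy) hne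
  rcases le_or_gt (y (Fin.castAdd 3 i)) (x (Fin.castAdd 3 i)) with h | h
  · exact ⟨_, (hconv.segment_subset hxs (left_mem_segment ..)).trans hsub, h⟩
  · exact ⟨_, (hconv.segment_subset hxs (right_mem_segment ..)).trans hsub, by linarith⟩

theorem single_mem_K33 (a : Fin 6) : (Pi.single a 1 : Fin 6 → ℝ) ∈ K33 := by
  obtain ⟨b, hb⟩ : ∃ b : Fin 6, a < 3 ↔ ¬ b < 3 := by revert a; decide
  exact segment_single_subset_K33 hb (left_mem_segment ..)

theorem single_pair_mem_K33OffDiag {a b : Fin 6} (h : a ≠ b) :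
    ((Pi.single a 1, Pi.single b 1) : (Fin 6 → ℝ) × (Fin 6 → ℝ)) ∈ K33OffDiag := by
  refine ⟨single_mem_K33 a, single_mem_K33 b, fun hab => ?_⟩
  simpa [Pi.single_eq_of_ne h] using congrFun hab a

theorem joinedIn_single_fst {a a' b : Fin 6} (h : a ≠ b) (h' : a' ≠ b) :
    JoinedIn K33OffDiag (Pi.single a 1, Pi.single b 1) (Pi.single a' 1, Pi.single b 1) := by
  have step : ∀ a a' : Fin 6, a ≠ b → a' ≠ b → (a < 3 ↔ ¬ a' < 3) →
      JoinedIn K33OffDiag (Pi.single a 1, Pi.single b 1) (Pi.single a' 1, Pi.single b 1) := by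
    intro a a' h h' hadj
    refine joinedIn_move_fst (single_pair_mem_K33OffDiag h) (segment_single_subset_K33 hadj) ?_
    rw [Pi.single_eq_of_ne h']
    exact (single_mem_stdSimplex ℝ a).1 a'
  by_cases hadj : a < 3 ↔ ¬ a' < 3
  · exact step a a' h h' hadj
  · obtain ⟨c, hcb, hc⟩ : ∃ c : Fin 6, c ≠ b ∧ (a < 3 ↔ ¬ c < 3) := by
      clear step hadj h h'; revert a b; decide
    exact (step a c h hcb hc).trans (step c a' hcb h' (by tauto))

theorem joinedIn_single_snd {a b b' : Fin 6} (h : a ≠ b) (h' : a ≠ b') :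
    JoinedIn K33OffDiag (Pi.single a 1, Pi.single b 1) (Pi.single a 1, Pi.single b' 1) := by
  have hmap : K33OffDiag = Prod.swap ⁻¹' K33OffDiag := by
    ext p
    exact ⟨fun h => ⟨h.2.1, h.1, h.2.2.symm⟩, fun h => ⟨h.2.1, h.1, h.2.2.symm⟩⟩
  obtain ⟨γ, hγ⟩ := joinedIn_single_fst h.symm h'.symm
  refine ⟨γ.map continuous_swap, fun t => ?_⟩
  have := hγ t
  rw [hmap] at this
  exact this

theorem joinedIn_single_pair {a b a' b' : Fin 6} (h : a ≠ b) (h' : a' ≠ b') :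
    JoinedIn K33OffDiag (Pi.single a 1, Pi.single b 1) (Pi.single a' 1, Pi.single b' 1) := by
  obtain ⟨c, hc, hc'⟩ : ∃ c : Fin 6, a ≠ c ∧ a' ≠ c := by
    clear h h'; revert a a'; decide
  exact ((joinedIn_single_snd h hc).trans (joinedIn_single_fst hc hc')).trans
    (joinedIn_single_snd hc' h')

theorem exists_joinedIn_single_pair {p : (Fin 6 → ℝ) × (Fin 6 → ℝ)} (hp : p ∈ K33OffDiag) :
    ∃ a b : Fin 6, a ≠ b ∧ JoinedIn K33OffDiag p (Pi.single a 1, Pi.single b 1) := by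
  obtain ⟨x, y⟩ := p
  obtain ⟨a, ha, hya⟩ := exists_vertex_move hp.1 hp.2.1
  have h₁ := joinedIn_move_fst hp ha hya
  have hq := h₁.target_mem
  obtain ⟨b, hb, hxb⟩ := exists_vertex_move hq.2.1 hq.1
  have h₂ := joinedIn_move_snd hq hb hxb
  refine ⟨a, b, ?_, h₁.trans h₂⟩
  rintro rfl
  exact h₂.target_mem.2.2 rfl

theorem isPathConnected_K33OffDiag : IsPathConnected K33OffDiag := by
  refine ⟨_, single_pair_mem_K33OffDiag (zero_ne_one : (0 : Fin 6) ≠ 1), fun {p} hp => ?_⟩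
  obtain ⟨a, b, hab, h⟩ := exists_joinedIn_single_pair hp
  exact (joinedIn_single_pair zero_ne_one hab).trans h.symm

/-- The ordered configuration space of two points on the complete bipartite graph `K₃,₃`
is path-connected. -/
theorem stmt15 : PathConnectedSpace (Conf ↥K33 2) := by
  have : PathConnectedSpace K33OffDiag :=
    isPathConnected_iff_pathConnectedSpace.1 isPathConnected_K33OffDiag
  let f : K33OffDiag → Conf ↥K33 2 := fun p =>
    ⟨![⟨p.1.1, p.2.1⟩, ⟨p.1.2, p.2.2.1⟩], by
      have h := p.2.2.2
      intro i j hij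
      fin_cases i <;> fin_cases j <;> simp_all [Subtype.ext_iff, eq_comm]⟩
  have hf : Continuous f := by
    refine Continuous.subtype_mk (continuous_pi fun i => ?_) _
    fin_cases i
    · exact (continuous_fst.comp continuous_subtype_val).subtype_mk _
    · exact (continuous_snd.comp continuous_subtype_val).subtype_mk _
  refine Function.Surjective.pathConnectedSpace (f := f) (fun g => ?_) hf
  refine ⟨⟨(g.1 0, g.1 1), (g.1 0).2, (g.1 1).2, fun h => ?_⟩, ?_⟩
  · exact zero_ne_one (g.2 (Subtype.ext h))
  · refine Subtype.ext (funext fun i => ?_)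
    fin_cases i <;> rfl
end
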